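/- There exists a universal constant C > 0 such that for every M > 0, if n ≥ C·max(s⋆·log p, s⋆·log M) and p ≥ C, then with probability at least 1 − 9·exp(−n/40) − 2/(n·p), simultaneously: λ_min(F_{n,θ_S}) ≥ n/(1030·exp(2·(M+1))) for every S ∈ 𝒮_{s⋆} and every θ_S ∈ ℝ^{|S|} with ‖θ_S‖₂ ≤ M, and λ_max(F_{n,θ_S}) ≤ 9n/4 for every S ∈ 𝒮_{s⋆} and every θ_S ∈ ℝ^{|S|}. -/

import Mathlib

open MeasureTheory ProbabilityTheory Matrix Real

/-- The law of an `n × p` matrix with i.i.d. standard normal entries. -/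
noncomputable def gaussMat (n p : ℕ) : Measure (Fin n → Fin p → ℝ) :=
  Measure.pi fun _ : Fin n => Measure.pi fun _ : Fin p => gaussianReal 0 1

/-- Smallest eigenvalue (Rayleigh quotient infimum over unit vectors). -/
noncomputable def lamMin {m : Type*} [Fintype m] (A : Matrix m m ℝ) : ℝ :=
  sInf {r : ℝ | ∃ u : m → ℝ, (∑ i, u i ^ 2) = 1 ∧ r = u ⬝ᵥ A.mulVec u}

/-- Largest eigenvalue (Rayleigh quotient supremum over unit vectors). -/
noncomputable def lamMax {m : Type*} [Fintype m] (A : Matrix m m ℝ) : ℝ :=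
  sSup {r : ℝ | ∃ u : m → ℝ, (∑ i, u i ^ 2) = 1 ∧ r = u ⬝ᵥ A.mulVec u}

/-- Weighted Gram matrix `∑ᵢ wᵢ · X_{i,S} X_{i,S}ᵀ`. -/
noncomputable def gramW {n p : ℕ} (S : Finset (Fin p)) (w : Fin n → ℝ)
    (x : Fin n → Fin p → ℝ) : Matrix S S ℝ :=
  Matrix.of fun j k => ∑ i, w i * x i j.1 * x i k.1

/-- The logistic variance function `b''(η) = exp η / (1 + exp η)²`. -/
noncomputable def logisticW (η : ℝ) : ℝ := Real.exp η / (1 + Real.exp η) ^ 2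

/-- A linear functional of a standard Gaussian vector is Gaussian. -/
lemma map_dotProduct_pi_gaussianReal {p : ℕ} (w : Fin p → ℝ) :
    (Measure.pi fun _ : Fin p => gaussianReal 0 1).map (fun x => ∑ j, x j * w j)
      = gaussianReal 0 (∑ j, w j ^ 2).toNNReal := by
  have hm : Measurable (fun x : Fin p → ℝ => ∑ j, x j * w j) := by fun_prop
  have : IsProbabilityMeasure ((Measure.pi fun _ : Fin p => gaussianReal 0 1).map
      (fun x => ∑ j, x j * w j)) := Measure.isProbabilityMeasure_map hm.aemeasurable
  apply Measure.ext_of_charFun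
  ext t
  have h := charFun_stdGaussian (E := EuclideanSpace ℝ (Fin p)) (WithLp.toLp 2 (fun j => t * w j))
  rw [← map_pi_eq_stdGaussian, charFun_apply,
    integral_map (Measurable.aemeasurable (by fun_prop))
      (Measurable.aestronglyMeasurable (by fun_prop))] at h
  rw [charFun_apply_real, integral_map hm.aemeasurable
    (Measurable.aestronglyMeasurable (by fun_prop)), charFun_gaussianReal]
  have hs : 0 ≤ ∑ j, w j ^ 2 := Finset.sum_nonneg fun _ _ => sq_nonneg _
  have hn : ‖WithLp.toLp 2 (fun j => t * w j)‖ ^ 2 = t ^ 2 * ∑ j, w j ^ 2 := by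
    rw [EuclideanSpace.norm_sq_eq, Finset.mul_sum]
    simp [mul_pow]
  rw [← Complex.ofReal_pow, hn] at h
  have e : ∀ x : Fin p → ℝ, (inner ℝ (WithLp.toLp 2 x) (WithLp.toLp 2 (fun j => t * w j)) : ℝ)
      = t * ∑ j, x j * w j := by
    intro x
    simp only [PiLp.inner_apply, Finset.mul_sum]
    refine Finset.sum_congr rfl fun j _ => ?_
    simp; ring
  simp only [e] at h
  rw [Real.coe_toNNReal _ hs]
  simp only [Complex.ofReal_mul] at h ⊢
  rw [h]
  congr 1
  push_cast
  ring

lemma lintegral_pi_prod_eq_pow {α : Type*} [MeasurableSpace α] (μ : Measure α)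
    [IsProbabilityMeasure μ] (n : ℕ) {f : α → ENNReal} (hf : Measurable f) :
    ∫⁻ x, ∏ i, f (x i) ∂(Measure.pi fun _ : Fin n => μ) = (∫⁻ y, f y ∂μ) ^ n := by
  rw [lintegral_prod_eq_prod_lintegral_of_indepFun Finset.univ (fun (i : Fin n) (x : Fin n → α) => f (x i))
    (iIndepFun_pi (X := fun _ => f) fun _ => hf.aemeasurable) (fun i => by fun_prop)]
  have : ∀ i : Fin n, ∫⁻ x, f (x i) ∂(Measure.pi fun _ : Fin n => μ) = ∫⁻ y, f y ∂μ := fun i =>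
    (measurePreserving_eval (fun _ : Fin n => μ) i).lintegral_comp hf
  simp [this]

/-- Chernoff's bound for sums of i.i.d. variables. -/
lemma measure_pi_le_exp {α : Type*} [MeasurableSpace α] (μ : Measure α)
    [IsProbabilityMeasure μ] (n : ℕ) {g : α → ℝ} (hg : Measurable g) (a c : ℝ)
    (h : ∫⁻ y, ENNReal.ofReal (exp (g y)) ∂μ ≤ ENNReal.ofReal (exp (a - c))) :
    (Measure.pi fun _ : Fin n => μ) {x | n * a ≤ ∑ i, g (x i)}
      ≤ ENNReal.ofReal (exp (-(c * n))) := by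
  have h1 : ∀ x : Fin n → α, ENNReal.ofReal (exp (∑ i, g (x i)))
      = ∏ i, ENNReal.ofReal (exp (g (x i))) := fun x => by
    rw [exp_sum, ENNReal.ofReal_prod_of_nonneg fun _ _ => (exp_pos _).le]
  calc _ ≤ (Measure.pi fun _ : Fin n => μ)
        {x | ENNReal.ofReal (exp (n * a)) ≤ ∏ i, ENNReal.ofReal (exp (g (x i)))} := by
        refine measure_mono fun x hx => ?_
        simp only [Set.mem_ofPred_eq] at hx ⊢
        rw [← h1]
        exact ENNReal.ofReal_le_ofReal (exp_le_exp.2 hx)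
    _ ≤ (∫⁻ x, ∏ i, ENNReal.ofReal (exp (g (x i))) ∂(Measure.pi fun _ : Fin n => μ))
        / ENNReal.ofReal (exp (n * a)) :=
        meas_ge_le_lintegral_div (Measurable.aemeasurable (by fun_prop)) (by simp [exp_pos]) (by simp)
    _ ≤ ENNReal.ofReal (exp (a - c)) ^ n / ENNReal.ofReal (exp (n * a)) := by
        rw [lintegral_pi_prod_eq_pow μ n (f := fun y => ENNReal.ofReal (exp (g y))) (by fun_prop)]
        gcongr
    _ = _ := by
        rw [← ENNReal.ofReal_pow (exp_pos _).le, ← ENNReal.ofReal_div_of_pos (exp_pos _),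
          ← exp_nat_mul, ← exp_sub]
        ring_nf

lemma lintegral_exp_sq_gaussianReal_le {v : NNReal} (hv : v ≤ 1) :
    ∫⁻ y, ENNReal.ofReal (exp (3 / 8 * y ^ 2)) ∂(gaussianReal 0 v) ≤ 2 := by
  by_cases h0 : v = 0
  · simp [h0]
  have hvp : 0 < (v : ℝ) := by positivity
  have hv1 : (v : ℝ) ≤ 1 := by exact_mod_cast hv
  rw [gaussianReal_of_var_ne_zero _ h0, lintegral_withDensity_eq_lintegral_mul _
    (measurable_gaussianPDF _ _) (by fun_prop)]
  set b : ℝ := 1 / (2 * v) - 3 / 8 with hb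
  have hbv : b * (2 * v) = 1 - 3 / 4 * v := by rw [hb]; field_simp; ring
  have hbp : 0 < b := by
    have : 0 < b * (2 * v) := by rw [hbv]; linarith
    exact pos_of_mul_pos_left this (by positivity)
  have e : ∀ y : ℝ, (gaussianPDF 0 v * fun y => ENNReal.ofReal (exp (3 / 8 * y ^ 2))) y
      = ENNReal.ofReal ((√(2 * π * v))⁻¹ * exp (-b * y ^ 2)) := fun y => by
    simp only [Pi.mul_apply, gaussianPDF_def, gaussianPDFReal_def]
    rw [← ENNReal.ofReal_mul (by positivity), mul_assoc, ← exp_add]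
    congr 3
    rw [hb]; field_simp; ring
  simp only [e]
  rw [← ofReal_integral_eq_lintegral_ofReal ((integrable_exp_neg_mul_sq hbp).const_mul _)
    (.of_forall fun y => by positivity), integral_const_mul, integral_gaussian,
    ← sqrt_inv, ← sqrt_mul (by positivity)]
  have : (2 * π * (v : ℝ))⁻¹ * (π / b) ≤ 2 ^ 2 := by
    have : (2 * π * (v : ℝ))⁻¹ * (π / b) = (b * (2 * v))⁻¹ := by field_simp
    rw [this, hbv]
    rw [inv_le_comm₀ (by linarith) (by norm_num)]
    linarith
  have h2 : √((2 * π * (v : ℝ))⁻¹ * (π / b)) ≤ 2 :=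
    (sqrt_le_sqrt this).trans (by rw [sqrt_sq (by norm_num)])
  calc _ ≤ ENNReal.ofReal 2 := ENNReal.ofReal_le_ofReal h2
    _ = 2 := by simp

lemma gaussianReal_abs_ge_le {v : NNReal} (hv : v ≤ 1) :
    gaussianReal 0 v {y | 15 / 8 ≤ |y|} ≤ ENNReal.ofReal (64 / 225) := by
  have h := meas_ge_le_variance_div_sq (μ := gaussianReal 0 v) (X := fun y : ℝ => y)
    (memLp_id_gaussianReal' 2 (by simp)) (c := 15 / 8) (by norm_num)
  rw [variance_fun_id_gaussianReal, integral_id_gaussianReal] at h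
  simp only [sub_zero] at h
  refine h.trans (ENNReal.ofReal_le_ofReal ?_)
  have hv1 : (v : ℝ) ≤ 1 := by exact_mod_cast hv
  norm_num
  linarith

lemma gaussianReal_abs_lt_le {v : NNReal} (hv : 9 / 10 ≤ (v : ℝ)) :
    gaussianReal 0 v {y | |y| < 1 / 2} ≤ ENNReal.ofReal (43 / 100) := by
  have h0 : v ≠ 0 := by rintro rfl; norm_num at hv
  rw [gaussianReal_apply _ h0]
  have hb : ∀ y, gaussianPDF 0 v y ≤ ENNReal.ofReal (43 / 100) := fun y => by
    rw [gaussianPDF_def, gaussianPDFReal_def]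
    refine ENNReal.ofReal_le_ofReal ?_
    have h1 : exp (-(y - 0) ^ 2 / (2 * v)) ≤ 1 := by
      rw [exp_le_one_iff, neg_div, neg_nonpos]; positivity
    have h2 : (√(2 * π * v))⁻¹ ≤ 43 / 100 := by
      rw [inv_le_comm₀ (by positivity) (by norm_num)]
      apply le_sqrt_of_sq_le
      nlinarith [pi_gt_d6, hv, mul_le_mul pi_gt_d6.le hv (by norm_num) pi_pos.le]
    calc _ ≤ (√(2 * π * v))⁻¹ * 1 := mul_le_mul_of_nonneg_left h1 (by positivity)
      _ ≤ _ := by linarith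
  calc _ ≤ ∫⁻ _ in {y : ℝ | |y| < 1 / 2}, ENNReal.ofReal (43 / 100) := lintegral_mono hb
    _ = _ := by
      rw [setLIntegral_const]
      have : {y : ℝ | |y| < 1 / 2} = Set.Ioo (-(1 / 2)) (1 / 2) := by ext; simp [abs_lt]
      rw [this, Real.volume_Ioo]; norm_num

lemma measurePreserving_dotProduct {p : ℕ} (w : Fin p → ℝ) :
    MeasurePreserving (fun x : Fin p → ℝ => ∑ j, x j * w j)
      (Measure.pi fun _ : Fin p => gaussianReal 0 1)
      (gaussianReal 0 (∑ j, w j ^ 2).toNNReal) :=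
  ⟨by fun_prop, map_dotProduct_pi_gaussianReal w⟩

lemma gaussMat_energy_le {n p : ℕ} (w : Fin p → ℝ) (hw : ∑ j, w j ^ 2 ≤ 1) :
    gaussMat n p {x | 4 * (n : ℝ) ≤ ∑ i, (∑ j, x i j * w j) ^ 2}
      ≤ ENNReal.ofReal (exp (-(1 / 10 * n))) := by
  refine le_trans (measure_mono ?_) (measure_pi_le_exp
    (Measure.pi fun _ : Fin p => gaussianReal 0 1) n
    (g := fun y => 3 / 8 * (∑ j, y j * w j) ^ 2) (by fun_prop) (3 / 2) (1 / 10) ?_)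
  · intro x hx
    simp only [Set.mem_ofPred_eq, ← Finset.mul_sum] at hx ⊢
    linarith
  · refine ((measurePreserving_dotProduct w).lintegral_comp
      (f := fun y => ENNReal.ofReal (exp (3 / 8 * y ^ 2))) (by fun_prop)).trans_le ?_
    refine (lintegral_exp_sq_gaussianReal_le (Real.toNNReal_le_one.2 hw)).trans ?_
    rw [← ENNReal.ofReal_ofNat]
    refine ENNReal.ofReal_le_ofReal ?_
    have := add_one_le_exp (3 / 2 - 1 / 10 : ℝ)
    linarith

open Classical in
/-- Indicator that one of two linear functionals of a vector is not of moderate size: the first is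
too large or the second is too small. -/
noncomputable def exceptional {p : ℕ} (v u : Fin p → ℝ) (y : Fin p → ℝ) : ℝ :=
  if 15 / 8 ≤ |∑ j, y j * v j| ∨ |∑ j, y j * u j| < 1 / 2 then 1 else 0

lemma gaussMat_exceptional_le {n p : ℕ} (v u : Fin p → ℝ) (hv : ∑ j, v j ^ 2 ≤ 1)
    (hu : 9 / 10 ≤ ∑ j, u j ^ 2) :
    gaussMat n p {x | (n : ℝ) * (19 / 20) ≤ ∑ i, exceptional v u (x i)}
      ≤ ENNReal.ofReal (exp (-(1 / 10 * n))) := by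
  set μ := Measure.pi fun _ : Fin p => gaussianReal 0 1
  set A : Set (Fin p → ℝ) := {y | 15 / 8 ≤ |∑ j, y j * v j|}
  set B : Set (Fin p → ℝ) := {y | |∑ j, y j * u j| < 1 / 2}
  have hA : MeasurableSet A := measurableSet_le (by fun_prop) (by fun_prop)
  have hB : MeasurableSet B := measurableSet_lt (by fun_prop) (by fun_prop)
  have hg : exceptional v u = (A ∪ B).indicator 1 := by
    ext y
    simp [exceptional, Set.indicator_apply, A, B]
  have hμA : μ A ≤ ENNReal.ofReal (64 / 225) :=
    ((measurePreserving_dotProduct v).measure_preimage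
      (measurableSet_le (by fun_prop) (by fun_prop)
        : MeasurableSet {y : ℝ | 15 / 8 ≤ |y|}).nullMeasurableSet).trans_le
      (gaussianReal_abs_ge_le (Real.toNNReal_le_one.2 hv))
  have hμB : μ B ≤ ENNReal.ofReal (43 / 100) :=
    ((measurePreserving_dotProduct u).measure_preimage
      (measurableSet_lt (by fun_prop) (by fun_prop)
        : MeasurableSet {y : ℝ | |y| < 1 / 2}).nullMeasurableSet).trans_le
      (gaussianReal_abs_lt_le (by rwa [Real.coe_toNNReal _ (by linarith)]))
  refine measure_pi_le_exp μ n (g := exceptional v u)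
    (by rw [hg]; exact measurable_one.indicator (hA.union hB)) (19 / 20) (1 / 10) ?_
  have he1 := exp_one_gt_d9
  have hind : ∀ y, ENNReal.ofReal (exp (exceptional v u y))
      = 1 + (A ∪ B).indicator (fun _ => ENNReal.ofReal (exp 1 - 1)) y := fun y => by
    rw [hg]
    by_cases hy : y ∈ A ∪ B
    · simp only [hy, Set.indicator_of_mem, Pi.one_apply]
      rw [← ENNReal.ofReal_one, ← ENNReal.ofReal_add zero_le_one (by linarith)]
      ring_nf
    · simp [hy]
  calc _ = 1 + ENNReal.ofReal (exp 1 - 1) * μ (A ∪ B) := by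
        simp only [hind]
        rw [lintegral_add_left measurable_const, lintegral_indicator_const (hA.union hB)]
        simp
    _ ≤ 1 + ENNReal.ofReal (exp 1 - 1) *
          (ENNReal.ofReal (64 / 225) + ENNReal.ofReal (43 / 100)) := by
        gcongr
        exact (measure_union_le A B).trans (add_le_add hμA hμB)
    _ = ENNReal.ofReal (1 + (exp 1 - 1) * (64 / 225 + 43 / 100)) := by
        rw [← ENNReal.ofReal_add (by norm_num) (by norm_num),
          ← ENNReal.ofReal_mul (by linarith), ← ENNReal.ofReal_one,
          ← ENNReal.ofReal_add zero_le_one (mul_nonneg (by linarith) (by norm_num))]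
    _ ≤ _ := by
        refine ENNReal.ofReal_le_ofReal ?_
        have h := sum_le_exp_of_nonneg (x := 19 / 20 - 1 / 10) (by norm_num) 4
        norm_num [Finset.sum_range_succ, Nat.factorial] at h
        have := exp_one_lt_d9
        norm_num
        linarith

/-- The vector in `ℝ^p` obtained by adding up `s` multiples of basis vectors, with coefficients in
`K⁻¹ℤ ∩ [-1, 1]`. -/
noncomputable def gridVec {s p K : ℕ} (c : Fin s → Fin p × Finset.Icc (-(K : ℤ)) K) :
    Fin p → ℝ :=
  fun j => ∑ t, if (c t).1 = j then (((c t).2 : ℤ) : ℝ) / K else 0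

lemma exists_int_abs_le_abs_sub_le (y : ℝ) : ∃ k : ℤ, |(k : ℝ)| ≤ |y| ∧ |y - k| ≤ 1 := by
  rcases le_total 0 y with h | h
  · refine ⟨⌊y⌋, ?_, ?_⟩
    · rw [abs_of_nonneg h, abs_of_nonneg (by exact_mod_cast Int.floor_nonneg.2 h)]
      exact Int.floor_le y
    · rw [abs_le]; constructor <;> linarith [Int.floor_le y, Int.lt_floor_add_one y]
  · refine ⟨⌈y⌉, ?_, ?_⟩
    · have : (⌈y⌉ : ℝ) ≤ 0 := by exact_mod_cast Int.ceil_le.2 (by simpa using h)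
      rw [abs_of_nonpos h, abs_of_nonpos this]
      linarith [Int.le_ceil y]
    · rw [abs_le]; constructor <;> linarith [Int.le_ceil y, Int.ceil_lt_add_one y]

lemma exists_gridVec_eq {s p K : ℕ} {S : Finset (Fin p)} (hS : S.Nonempty) (hs : S.card ≤ s)
    (k : Fin p → ℤ) (hk : ∀ j, |k j| ≤ K) (hkS : ∀ j ∉ S, k j = 0) :
    ∃ c : Fin s → Fin p × Finset.Icc (-(K : ℤ)) K, gridVec c = fun j => (k j : ℝ) / K := by
  obtain ⟨j₀, -⟩ := hS
  obtain ⟨e⟩ : Nonempty (S ↪ Fin s) := Function.Embedding.nonempty_of_card_le (by simpa using hs)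
  refine ⟨Function.extend e (fun j => (j.1, ⟨k j, Finset.mem_Icc.2 (abs_le.1 (hk j))⟩))
    fun _ => (j₀, ⟨0, by simp⟩), ?_⟩
  ext j
  unfold gridVec
  by_cases hj : j ∈ S
  · rw [Finset.sum_eq_single (e ⟨j, hj⟩)]
    · simp [e.injective.extend_apply]
    · intro t _ ht
      by_cases h : ∃ a, e a = t
      · obtain ⟨a, rfl⟩ := h
        rw [e.injective.extend_apply, if_neg]
        rintro rfl
        exact ht rfl
      · rw [Function.extend_apply' _ _ _ h]
        simp
    · simp
  · rw [hkS j hj]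
    simp only [Int.cast_zero, zero_div]
    refine Finset.sum_eq_zero fun t _ => ?_
    by_cases h : ∃ a, e a = t
    · obtain ⟨a, rfl⟩ := h
      rw [e.injective.extend_apply, if_neg]
      rintro rfl
      exact hj a.2
    · rw [Function.extend_apply' _ _ _ h]
      simp

lemma exists_gridVec_near {s p K : ℕ} (hK : 0 < K) {S : Finset (Fin p)} (hS : S.Nonempty)
    (hs : S.card ≤ s) (u : Fin p → ℝ) (hu : ∑ j, u j ^ 2 ≤ 1) (huS : ∀ j ∉ S, u j = 0) :
    ∃ c : Fin s → Fin p × Finset.Icc (-(K : ℤ)) K, ∑ j, gridVec c j ^ 2 ≤ 1 ∧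
      (∀ j, |u j - gridVec c j| ≤ 1 / K) ∧ ∀ j ∉ S, gridVec c j = 0 := by
  have hK' : (0 : ℝ) < K := by exact_mod_cast hK
  choose k hk1 hk2 using fun j => exists_int_abs_le_abs_sub_le (K * u j)
  have hle : ∀ j, |(k j : ℝ) / K| ≤ |u j| := fun j => by
    rw [abs_div, abs_of_pos hK', div_le_iff₀ hK', mul_comm]
    simpa [abs_mul] using hk1 j
  have hu1 : ∀ j, |u j| ≤ 1 := fun j => by
    rw [← sq_le_one_iff_abs_le_one]
    exact (Finset.single_le_sum (f := fun j => u j ^ 2) (fun _ _ => sq_nonneg _)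
      (Finset.mem_univ j)).trans hu
  have hkS : ∀ j ∉ S, k j = 0 := fun j hj => by
    have := hk1 j
    simpa [huS j hj] using this
  obtain ⟨c, hc⟩ := exists_gridVec_eq (K := K) hS hs k (fun j => by
    have : |(k j : ℝ)| ≤ K := (hk1 j).trans (by
      rw [abs_mul, abs_of_pos hK']
      exact mul_le_of_le_one_right hK'.le (hu1 j))
    exact_mod_cast this) hkS
  refine ⟨c, ?_, fun j => ?_, fun j hj => ?_⟩
  · rw [hc]
    exact (Finset.sum_le_sum fun j _ => sq_le_sq.2 (hle j)).trans hu
  · rw [hc]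
    have : u j - (k j : ℝ) / K = (K * u j - k j) / K := by field_simp
    rw [this, abs_div, abs_of_pos hK']
    gcongr
    exact hk2 j
  · simp [hc, hkS j hj]

lemma logisticW_nonneg (η : ℝ) : 0 ≤ logisticW η := by unfold logisticW; positivity

lemma logisticW_le (η : ℝ) : logisticW η ≤ 1 / 4 := by
  unfold logisticW
  rw [div_le_iff₀ (by positivity)]
  nlinarith [sq_nonneg (1 - exp η)]

lemma exp_neg_div_four_le_logisticW {η B : ℝ} (h : |η| ≤ B) :
    exp (-B) / 4 ≤ logisticW η := by
  obtain ⟨h1, h2⟩ := abs_le.1 h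
  unfold logisticW
  rw [le_div_iff₀ (by positivity)]
  have hp := exp_pos η
  rcases le_total η 0 with h0 | h0
  · have : exp (-B) ≤ exp η := exp_le_exp.2 h1
    have h3 : (1 + exp η) ^ 2 ≤ 4 := by nlinarith [exp_le_one_iff.2 h0]
    nlinarith [exp_pos (-B)]
  · have : exp (-B) ≤ exp (-η) := exp_le_exp.2 (by linarith)
    have h3 : (1 + exp η) ^ 2 ≤ 4 * exp η ^ 2 := by nlinarith [one_le_exp_iff.2 h0]
    calc exp (-B) / 4 * (1 + exp η) ^ 2 ≤ exp (-η) / 4 * (4 * exp η ^ 2) := by gcongr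
      _ = (exp (-η) * exp η) * exp η := by ring
      _ = exp η := by rw [← exp_add]; simp

/-- If all columns of `x` have squared norm at most `a`, then `‖x d‖² ≤ a (|S| b)²` for any
vector `d` supported on `S` whose entries are at most `b` in absolute value. -/
lemma sum_sq_sum_mul_le {n p : ℕ} (x : Fin n → Fin p → ℝ) {a b : ℝ} (ha : 0 ≤ a)
    (hx : ∀ j, ∑ i, x i j ^ 2 ≤ a) (S : Finset (Fin p)) (d : Fin p → ℝ)
    (hd : ∀ j, |d j| ≤ b) (hdS : ∀ j ∉ S, d j = 0) :
    ∑ i, (∑ j, x i j * d j) ^ 2 ≤ a * (S.card * b) ^ 2 := by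
  have h1 : ∀ i, ∑ j, x i j * d j = ∑ j ∈ S, x i j * d j := fun i =>
    (Finset.sum_subset (Finset.subset_univ S) fun j _ hj => by simp [hdS j hj]).symm
  have h2 : ∑ j ∈ S, d j ^ 2 ≤ S.card * b ^ 2 := by
    refine (Finset.sum_le_card_nsmul S _ (b ^ 2) fun j _ => ?_).trans_eq (by simp)
    exact sq_le_sq' (abs_le.1 (hd j)).1 (abs_le.1 (hd j)).2
  calc ∑ i, (∑ j, x i j * d j) ^ 2
      ≤ ∑ i, (∑ j ∈ S, x i j ^ 2) * (∑ j ∈ S, d j ^ 2) :=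
        Finset.sum_le_sum fun i _ => by rw [h1]; exact Finset.sum_mul_sq_le_sq_mul_sq _ _ _
    _ = (∑ j ∈ S, ∑ i, x i j ^ 2) * (∑ j ∈ S, d j ^ 2) := by
        rw [← Finset.sum_mul, Finset.sum_comm]
    _ ≤ (S.card * a) * (S.card * b ^ 2) := by
        refine mul_le_mul ((Finset.sum_le_card_nsmul S _ a fun j _ => hx j).trans_eq (by simp)) h2
          (Finset.sum_nonneg fun _ _ => sq_nonneg _) (by positivity)
    _ = _ := by ring

/-- Deterministic regularity of a design matrix on a grid of sparse vectors; this implies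
bounds for all sparse vectors. -/
structure IsRegularDesign {n p : ℕ} (s K : ℕ) (x : Fin n → Fin p → ℝ) : Prop where
  col_le : ∀ j, ∑ i, x i j ^ 2 ≤ 4 * n
  energy_le : ∀ c : Fin s → Fin p × Finset.Icc (-(K : ℤ)) K, ∑ j, gridVec c j ^ 2 ≤ 1 →
    ∑ i, (∑ j, x i j * gridVec c j) ^ 2 ≤ 4 * n
  exceptional_le : ∀ c d : Fin s → Fin p × Finset.Icc (-(K : ℤ)) K, ∑ j, gridVec c j ^ 2 ≤ 1 →
    9 / 10 ≤ ∑ j, gridVec d j ^ 2 →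
      ∑ i, exceptional (gridVec c) (gridVec d) (x i) ≤ n * (19 / 20)

namespace IsRegularDesign

variable {n p s : ℕ} {x : Fin n → Fin p → ℝ}

lemma exists_gridVec (hx : IsRegularDesign s (250 * p) x) (hsp : s ≤ p) {S : Finset (Fin p)}
    (hS : S.Nonempty) (hs : S.card ≤ s) (u : Fin p → ℝ) (hu : ∑ j, u j ^ 2 ≤ 1)
    (huS : ∀ j ∉ S, u j = 0) :
    ∃ c : Fin s → Fin p × Finset.Icc (-((250 * p : ℕ) : ℤ)) (250 * p : ℕ),
      ∑ j, gridVec c j ^ 2 ≤ 1 ∧ ∑ j, (u j - gridVec c j) ^ 2 ≤ 1 / 62500 ∧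
      ∑ i, (∑ j, x i j * u j - ∑ j, x i j * gridVec c j) ^ 2 ≤ 4 * n / 62500 := by
  obtain ⟨j₀, -⟩ := id hS
  have hp : 1 ≤ p := by have := j₀.2; omega
  have hpR : (1 : ℝ) ≤ p := by exact_mod_cast hp
  obtain ⟨c, h1, h2, h3⟩ := exists_gridVec_near (K := 250 * p) (by omega) hS hs u hu huS
  have hSp : (S.card : ℝ) ≤ p := by exact_mod_cast hs.trans hsp
  push_cast at h2
  have hb : (0 : ℝ) ≤ 1 / (250 * p) := by positivity
  have hSb : (S.card : ℝ) * (1 / (250 * p)) ≤ 1 / 250 := by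
    calc (S.card : ℝ) * (1 / (250 * p)) ≤ p * (1 / (250 * p)) := by gcongr
      _ = 1 / 250 := by field_simp
  have hSb0 : 0 ≤ (S.card : ℝ) * (1 / (250 * p)) := by positivity
  refine ⟨c, h1, ?_, ?_⟩
  · calc ∑ j, (u j - gridVec c j) ^ 2 ≤ ∑ _j : Fin p, (1 / (250 * (p : ℝ))) ^ 2 :=
          Finset.sum_le_sum fun j _ => sq_le_sq' (abs_le.1 (h2 j)).1 (abs_le.1 (h2 j)).2
      _ = 1 / (62500 * p) := by simp; field_simp; norm_num
      _ ≤ 1 / 62500 := by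
        apply one_div_le_one_div_of_le (by norm_num)
        linarith
  · have := sum_sq_sum_mul_le x (by positivity) hx.col_le S (fun j => u j - gridVec c j) h2
      fun j hj => by rw [huS j hj, h3 j hj, sub_zero]
    simp only [mul_sub, Finset.sum_sub_distrib] at this
    refine this.trans ?_
    calc 4 * (n : ℝ) * (S.card * (1 / (250 * p))) ^ 2 ≤ 4 * n * (1 / 250) ^ 2 := by gcongr
      _ = _ := by ring

lemma sum_sq_le (hx : IsRegularDesign s (250 * p) x) (hsp : s ≤ p) {S : Finset (Fin p)}
    (hS : S.Nonempty) (hs : S.card ≤ s) (u : Fin p → ℝ) (hu : ∑ j, u j ^ 2 ≤ 1)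
    (huS : ∀ j ∉ S, u j = 0) :
    ∑ i, (∑ j, x i j * u j) ^ 2 ≤ 9 * n := by
  obtain ⟨c, h1, -, h3⟩ := hx.exists_gridVec hsp hS hs u hu huS
  have h4 := hx.energy_le c h1
  have hn : (0 : ℝ) ≤ n := Nat.cast_nonneg n
  calc ∑ i, (∑ j, x i j * u j) ^ 2
      ≤ ∑ i, (2 * (∑ j, x i j * u j - ∑ j, x i j * gridVec c j) ^ 2
          + 2 * (∑ j, x i j * gridVec c j) ^ 2) := Finset.sum_le_sum fun i _ => by
        nlinarith [sq_nonneg (∑ j, x i j * u j - 2 * ∑ j, x i j * gridVec c j)]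
    _ ≤ 9 * n := by
        rw [Finset.sum_add_distrib, ← Finset.mul_sum, ← Finset.mul_sum]
        linarith

lemma le_sum_logisticW_mul_sq (hx : IsRegularDesign s (250 * p) x) (hsp : s ≤ p)
    {S : Finset (Fin p)} (hS : S.Nonempty) (hs : S.card ≤ s) {M : ℝ} (hM : 0 < M)
    (θ u : Fin p → ℝ) (hθ : ∑ j, θ j ^ 2 ≤ M ^ 2) (hθS : ∀ j ∉ S, θ j = 0)
    (hu : ∑ j, u j ^ 2 = 1) (huS : ∀ j ∉ S, u j = 0) :
    n / (1030 * exp (2 * (M + 1)))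
      ≤ ∑ i, logisticW (∑ j, x i j * θ j) * (∑ j, x i j * u j) ^ 2 := by
  have hn : (0 : ℝ) ≤ n := Nat.cast_nonneg n
  obtain ⟨c, hc1, -, hc3⟩ := hx.exists_gridVec hsp hS hs (fun j => θ j / M) (by
    simp only [div_pow, ← Finset.sum_div]
    exact (div_le_one (by positivity)).2 hθ) fun j hj => by simp [hθS j hj]
  obtain ⟨d, hd1, hd2, hd3⟩ := hx.exists_gridVec hsp hS hs u hu.le huS
  have hd : 9 / 10 ≤ ∑ j, gridVec d j ^ 2 := by
    have : ∑ j, u j ^ 2 ≤ ∑ j, (101 * (u j - gridVec d j) ^ 2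
        + 101 / 100 * gridVec d j ^ 2) := Finset.sum_le_sum fun j _ => by
      nlinarith [sq_nonneg (10 * (u j - gridVec d j) - gridVec d j / 10)]
    rw [Finset.sum_add_distrib, ← Finset.mul_sum, ← Finset.mul_sum] at this
    linarith
  have hexc := hx.exceptional_le c d hc1 hd
  have key : ∀ i, exp (-(2 * M)) / 4 * (9 / 64) * (1 - exceptional (gridVec c) (gridVec d) (x i)
      - 64 * (∑ j, x i j * (θ j / M) - ∑ j, x i j * gridVec c j) ^ 2
      - 64 * (∑ j, x i j * u j - ∑ j, x i j * gridVec d j) ^ 2)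
      ≤ logisticW (∑ j, x i j * θ j) * (∑ j, x i j * u j) ^ 2 := by
    intro i
    set a := ∑ j, x i j * (θ j / M) - ∑ j, x i j * gridVec c j with ha
    set b := ∑ j, x i j * u j - ∑ j, x i j * gridVec d j with hb
    have hpos : 0 ≤ logisticW (∑ j, x i j * θ j) * (∑ j, x i j * u j) ^ 2 :=
      mul_nonneg (logisticW_nonneg _) (sq_nonneg _)
    rcases le_or_gt (1 - exceptional (gridVec c) (gridVec d) (x i) - 64 * a ^ 2 - 64 * b ^ 2) 0
      with h0 | h0
    · exact (mul_nonpos_of_nonneg_of_nonpos (by positivity) h0).trans hpos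
    have hE : exceptional (gridVec c) (gridVec d) (x i) = 0 ∧
        |∑ j, x i j * gridVec c j| < 15 / 8 ∧ 1 / 2 ≤ |∑ j, x i j * gridVec d j| := by
      unfold exceptional at h0 ⊢
      split_ifs at h0 ⊢ with h
      · nlinarith [sq_nonneg a, sq_nonneg b]
      · push Not at h
        exact ⟨rfl, h⟩
    obtain ⟨hE0, hEc, hEd⟩ := hE
    rw [hE0] at h0 ⊢
    have ha1 : |a| < 1 / 8 := abs_lt_of_sq_lt_sq (by nlinarith [sq_nonneg b]) (by norm_num)
    have hb1 : |b| < 1 / 8 := abs_lt_of_sq_lt_sq (by nlinarith [sq_nonneg a]) (by norm_num)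
    have hθM : |∑ j, x i j * θ j| ≤ 2 * M := by
      have e : ∑ j, x i j * θ j = (∑ j, x i j * gridVec c j + a) * M := by
        rw [ha, add_sub_cancel, Finset.sum_mul]
        exact Finset.sum_congr rfl fun j _ => by field_simp
      rw [e, abs_mul, abs_of_pos hM]
      gcongr
      linarith [abs_add_le (∑ j, x i j * gridVec c j) a]
    have hu1 : (3 / 8) ^ 2 ≤ (∑ j, x i j * u j) ^ 2 := by
      rw [sq_le_sq, abs_of_pos (by norm_num : (0 : ℝ) < 3 / 8)]
      have e : ∑ j, x i j * gridVec d j = ∑ j, x i j * u j - b := by rw [hb]; ring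
      rw [e] at hEd
      linarith [abs_sub (∑ j, x i j * u j) b]
    calc _ ≤ exp (-(2 * M)) / 4 * (9 / 64) * 1 := by
          gcongr
          nlinarith [sq_nonneg a, sq_nonneg b]
      _ = exp (-(2 * M)) / 4 * (3 / 8) ^ 2 := by ring
      _ ≤ _ := mul_le_mul (exp_neg_div_four_le_logisticW hθM) hu1 (by positivity)
          (logisticW_nonneg _)
  refine le_trans ?_ (Finset.sum_le_sum fun i _ => key i)
  rw [← Finset.mul_sum, Finset.sum_sub_distrib, Finset.sum_sub_distrib, Finset.sum_sub_distrib,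
    ← Finset.mul_sum, ← Finset.mul_sum]
  simp only [Finset.sum_const, Finset.card_univ, Fintype.card_fin, nsmul_eq_mul, mul_one]
  calc (n : ℝ) / (1030 * exp (2 * (M + 1))) ≤ n / (1030 * exp (2 * M)) := by
        gcongr
        linarith
    _ = exp (-(2 * M)) * (n / 1030) := by rw [exp_neg]; field_simp
    _ ≤ exp (-(2 * M)) * (9 / 256 * (1 / 25 * n)) := by gcongr; linarith
    _ = exp (-(2 * M)) / 4 * (9 / 64) * (1 / 25 * n) := by ring
    _ ≤ _ := by gcongr; linarith

end IsRegularDesign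

lemma dotProduct_gramW_mulVec {n p : ℕ} (S : Finset (Fin p)) (w : Fin n → ℝ)
    (x : Fin n → Fin p → ℝ) (u : S → ℝ) :
    u ⬝ᵥ (gramW S w x).mulVec u = ∑ i, w i * (∑ j : S, x i j.1 * u j) ^ 2 := by
  have h : ∀ j : S, u j * ∑ k : S, (∑ i, w i * x i j * x i k) * u k
      = ∑ i, w i * ((x i j * u j) * ∑ k : S, x i k * u k) := fun j => by
    simp only [Finset.sum_mul, Finset.mul_sum]
    rw [Finset.sum_comm]
    exact Finset.sum_congr rfl fun i _ => Finset.sum_congr rfl fun k _ => by ring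
  simp only [dotProduct, mulVec, gramW, of_apply, h]
  rw [Finset.sum_comm]
  simp only [← Finset.mul_sum, ← Finset.sum_mul, sq]

lemma sum_extend_zero {p : ℕ} (S : Finset (Fin p)) (u : S → ℝ) (f : Fin p → ℝ → ℝ)
    (hf : ∀ j, f j 0 = 0) :
    ∑ j, f j (Function.extend Subtype.val u 0 j) = ∑ j : S, f j.1 (u j) := by
  rw [← Finset.sum_subset (Finset.subset_univ S), ← Finset.sum_coe_sort]
  · exact Finset.sum_congr rfl fun j _ => by rw [Subtype.val_injective.extend_apply]
  · intro j _ hj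
    rw [Function.extend_apply' _ _ _ (by rintro ⟨a, rfl⟩; exact hj a.2)]
    exact hf j

lemma IsRegularDesign.le_lamMin_and_lamMax_le {n p s : ℕ} {x : Fin n → Fin p → ℝ}
    (hx : IsRegularDesign s (250 * p) x) (hsp : s ≤ p) {M : ℝ} (hM : 0 < M) :
    (∀ S : Finset (Fin p), S.Nonempty → S.card ≤ s →
      ∀ θs : S → ℝ, Real.sqrt (∑ j, θs j ^ 2) ≤ M →
        (n : ℝ) / (1030 * Real.exp (2 * (M + 1)))
          ≤ lamMin (gramW S (fun i => logisticW (∑ j : S, x i j.1 * θs j)) x)) ∧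
    (∀ S : Finset (Fin p), S.Nonempty → S.card ≤ s →
      ∀ θs : S → ℝ,
        lamMax (gramW S (fun i => logisticW (∑ j : S, x i j.1 * θs j)) x)
          ≤ 9 * (n : ℝ) / 4) := by
  have hunit : ∀ S : Finset (Fin p), S.Nonempty → ∃ u : S → ℝ, ∑ j, u j ^ 2 = 1 := by
    rintro S ⟨j, hj⟩
    exact ⟨Pi.single ⟨j, hj⟩ 1, by simp [Pi.single_apply]⟩
  have hext : ∀ (S : Finset (Fin p)) (u : S → ℝ), ∀ j ∉ S,
      Function.extend Subtype.val u 0 j = 0 := fun S u j hj => by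
    rw [Function.extend_apply' _ _ _ (by rintro ⟨a, rfl⟩; exact hj a.2)]; rfl
  have hlin : ∀ (S : Finset (Fin p)) (u : S → ℝ) (i : Fin n),
      ∑ j : S, x i j.1 * u j = ∑ j, x i j * Function.extend Subtype.val u 0 j := fun S u i =>
    (sum_extend_zero S u (fun j t => x i j * t) (by simp)).symm
  have hsq : ∀ (S : Finset (Fin p)) (u : S → ℝ),
      ∑ j, u j ^ 2 = ∑ j, Function.extend Subtype.val u 0 j ^ 2 := fun S u =>
    (sum_extend_zero S u (fun _ t => t ^ 2) (by simp)).symm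
  refine ⟨fun S hS hs θ hθ => ?_, fun S hS hs θ => ?_⟩
  · obtain ⟨u₀, hu₀⟩ := hunit S hS
    refine le_csInf ⟨_, u₀, hu₀, rfl⟩ ?_
    rintro r ⟨u, hu, rfl⟩
    rw [dotProduct_gramW_mulVec]
    simp only [hlin]
    refine hx.le_sum_logisticW_mul_sq hsp hS hs hM _ _ ?_ (hext S θ) ?_ (hext S u)
    · rw [← hsq]
      exact (sqrt_le_left hM.le).1 hθ
    · rw [← hsq, hu]
  · obtain ⟨u₀, hu₀⟩ := hunit S hS
    refine csSup_le ⟨_, u₀, hu₀, rfl⟩ ?_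
    rintro r ⟨u, hu, rfl⟩
    rw [dotProduct_gramW_mulVec]
    have := hx.sum_sq_le hsp hS hs _ ((hsq S u).symm.trans hu).le (hext S u)
    simp only [← hlin] at this
    calc _ ≤ ∑ i, 1 / 4 * (∑ j : S, x i j.1 * u j) ^ 2 :=
          Finset.sum_le_sum fun i _ => mul_le_mul_of_nonneg_right (logisticW_le _) (sq_nonneg _)
      _ ≤ 9 * n / 4 := by rw [← Finset.mul_sum]; linarith

lemma gaussMat_not_isRegularDesign_le (n p s : ℕ) {K : ℕ} :
    gaussMat n p {x | ¬ IsRegularDesign s K x} ≤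
      (p + (p * (2 * K + 1)) ^ s + ((p * (2 * K + 1)) ^ s) ^ 2 : ℕ)
        * ENNReal.ofReal (exp (-(1 / 10 * n))) := by
  set N := Fin s → Fin p × Finset.Icc (-(K : ℤ)) K
  set q := ENNReal.ofReal (exp (-(1 / 10 * n)))
  have hN : Fintype.card N = (p * (2 * K + 1)) ^ s := by
    have : ((K : ℤ) + 1 + K).toNat = 2 * K + 1 := by omega
    simp [N, this]
  let A : Fin p → Set (Fin n → Fin p → ℝ) := fun j => {x | 4 * (n : ℝ) ≤ ∑ i, x i j ^ 2}
  let B : N → Set (Fin n → Fin p → ℝ) := fun c => {x | ∑ j, gridVec c j ^ 2 ≤ 1 ∧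
    4 * (n : ℝ) ≤ ∑ i, (∑ j, x i j * gridVec c j) ^ 2}
  let D : N × N → Set (Fin n → Fin p → ℝ) := fun c => {x | ∑ j, gridVec c.1 j ^ 2 ≤ 1 ∧
    9 / 10 ≤ ∑ j, gridVec c.2 j ^ 2 ∧
      (n : ℝ) * (19 / 20) ≤ ∑ i, exceptional (gridVec c.1) (gridVec c.2) (x i)}
  have hA : ∀ j, gaussMat n p (A j) ≤ q := fun j => by
    have := gaussMat_energy_le (n := n) (p := p) (Pi.single j 1) (by simp [Pi.single_apply])
    simpa only [Pi.single_apply, mul_ite, mul_one, mul_zero, Finset.sum_ite_eq',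
      Finset.sum_ite_eq, Finset.mem_univ, if_true] using this
  have hB : ∀ c, gaussMat n p (B c) ≤ q := fun c => by
    by_cases h : ∑ j, gridVec c j ^ 2 ≤ 1
    · exact (measure_mono fun x hx => hx.2).trans (gaussMat_energy_le _ h)
    · simp [B, h]
  have hD : ∀ c, gaussMat n p (D c) ≤ q := fun c => by
    by_cases h : ∑ j, gridVec c.1 j ^ 2 ≤ 1 ∧ 9 / 10 ≤ ∑ j, gridVec c.2 j ^ 2
    · exact (measure_mono fun x hx => hx.2.2).trans (gaussMat_exceptional_le _ _ h.1 h.2)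
    · have : D c = ∅ := by
        ext x
        simpa [D] using fun h1 h2 => (h ⟨h1, h2⟩).elim
      simp [this]
  have hsub : {x | ¬ IsRegularDesign s K x} ⊆ ((⋃ j, A j) ∪ ⋃ c, B c) ∪ ⋃ c, D c := by
    intro x hx
    by_contra hcon
    simp only [Set.mem_union, Set.mem_iUnion, not_or, not_exists] at hcon
    obtain ⟨⟨h1, h2⟩, h3⟩ := hcon
    refine hx ⟨fun j => ?_, fun c hc => ?_, fun c d hc hd => ?_⟩
    · exact (not_le.1 (h1 j)).le
    · exact (not_le.1 fun h => h2 c ⟨hc, h⟩).le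
    · exact (not_le.1 fun h => h3 (c, d) ⟨hc, hd, h⟩).le
  have hunion : ∀ {ι : Type} [Fintype ι] (E : ι → Set (Fin n → Fin p → ℝ)),
      (∀ i, gaussMat n p (E i) ≤ q) → gaussMat n p (⋃ i, E i) ≤ Fintype.card ι * q := by
    intro ι _ E hE
    refine (measure_iUnion_fintype_le _ _).trans ((Finset.sum_le_sum fun i _ => hE i).trans_eq ?_)
    simp
  calc _ ≤ gaussMat n p (((⋃ j, A j) ∪ ⋃ c, B c) ∪ ⋃ c, D c) := measure_mono hsub
    _ ≤ (gaussMat n p (⋃ j, A j) + gaussMat n p (⋃ c, B c)) + gaussMat n p (⋃ c, D c) :=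
        (measure_union_le _ _).trans (add_le_add_left (measure_union_le _ _) _)
    _ ≤ (Fintype.card (Fin p) * q + Fintype.card N * q) + Fintype.card (N × N) * q :=
        add_le_add (add_le_add (hunion A hA) (hunion B hB)) (hunion D hD)
    _ = _ := by
        rw [Fintype.card_prod, hN, Fintype.card_fin]
        push_cast
        ring

lemma card_grid_mul_exp_le {n p s : ℕ} (hs : 1 ≤ s) (hp : 1000 ≤ p)
    (hn : 1000 * (s * Real.log p) ≤ n) :
    ((p + (p * (2 * (250 * p) + 1)) ^ s + ((p * (2 * (250 * p) + 1)) ^ s) ^ 2 : ℕ) : ℝ)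
      * exp (-(1 / 10 * n)) ≤ 9 * exp (-(n : ℝ) / 40) := by
  have h1 : p * (2 * (250 * p) + 1) ≤ p ^ 3 := by
    have : 2 * (250 * p) + 1 ≤ p * p := by nlinarith
    calc _ ≤ p * (p * p) := by gcongr
      _ = _ := by ring
  have h2 : (p * (2 * (250 * p) + 1)) ^ s ≤ p ^ (3 * s) := by
    rw [pow_mul]; gcongr
  have hle : ∀ k, k ≤ 6 * s → p ^ k ≤ p ^ (6 * s) := fun k hk =>
    Nat.pow_le_pow_right (by omega) hk
  have h3 : p + (p * (2 * (250 * p) + 1)) ^ s + ((p * (2 * (250 * p) + 1)) ^ s) ^ 2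
      ≤ 3 * p ^ (6 * s) := by
    have a1 : p ≤ p ^ (6 * s) := by simpa using hle 1 (by omega)
    have a2 := h2.trans (hle (3 * s) (by omega))
    have a3 : ((p * (2 * (250 * p) + 1)) ^ s) ^ 2 ≤ p ^ (6 * s) := by
      calc _ ≤ (p ^ (3 * s)) ^ 2 := by gcongr
        _ = _ := by rw [← pow_mul]; ring_nf
    omega
  have h4 : ((3 * p ^ (6 * s) : ℕ) : ℝ) = 3 * exp (6 * (s * Real.log p)) := by
    have hp0 : (0 : ℝ) < p := by exact_mod_cast (by omega : 0 < p)
    push_cast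
    rw [show 6 * ((s : ℝ) * Real.log p) = ((6 * s : ℕ) : ℝ) * Real.log p by push_cast; ring,
      exp_nat_mul, exp_log hp0]
  have hn0 : (0 : ℝ) ≤ n := Nat.cast_nonneg n
  calc _ ≤ ((3 * p ^ (6 * s) : ℕ) : ℝ) * exp (-(1 / 10 * n)) := by gcongr
    _ = 3 * exp (6 * (s * Real.log p) - 1 / 10 * n) := by
        rw [h4, mul_assoc, ← exp_add]; ring_nf
    _ ≤ 3 * exp (-(n : ℝ) / 40) := by
        gcongr
        linarith
    _ ≤ _ := by linarith [exp_pos (-(n : ℝ) / 40)]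

/-- uniform eigenvalue bounds for the logistic Fisher information, over a
ball of coefficients. -/
theorem stmt_18 : ∃ C : ℝ, 0 < C ∧
    ∀ M : ℝ, 0 < M →
    ∀ n p sstar : ℕ, 1 ≤ n → 1 ≤ sstar → sstar ≤ p → C ≤ (p : ℝ) →
      C * max ((sstar : ℝ) * Real.log p) ((sstar : ℝ) * Real.log M) ≤ (n : ℝ) →
      1 - ENNReal.ofReal (9 * Real.exp (-(n : ℝ) / 40) + 2 / ((n : ℝ) * p)) ≤
        gaussMat n p {x |
          (∀ S : Finset (Fin p), S.Nonempty → S.card ≤ sstar →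
            ∀ θs : S → ℝ, Real.sqrt (∑ j, θs j ^ 2) ≤ M →
              (n : ℝ) / (1030 * Real.exp (2 * (M + 1)))
                ≤ lamMin (gramW S (fun i => logisticW (∑ j : S, x i j.1 * θs j)) x)) ∧
          (∀ S : Finset (Fin p), S.Nonempty → S.card ≤ sstar →
            ∀ θs : S → ℝ,
              lamMax (gramW S (fun i => logisticW (∑ j : S, x i j.1 * θs j)) x)
                ≤ 9 * (n : ℝ) / 4)} := by
  refine ⟨1000, by norm_num, fun M hM n p s _ hs hsp hp hC => ?_⟩
  have hlog : 1000 * (s * Real.log p) ≤ n :=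
    (mul_le_mul_of_nonneg_left (le_max_left _ _) (by norm_num)).trans hC
  have : IsProbabilityMeasure (gaussMat n p) := by unfold gaussMat; infer_instance
  rw [tsub_le_iff_right, ← measure_univ (μ := gaussMat n p)]
  refine (measure_mono (t := _ ∪ {x | ¬ IsRegularDesign s (250 * p) x}) fun x _ => ?_).trans
    ((measure_union_le _ _).trans (add_le_add_right ?_ _))
  · by_cases hx : IsRegularDesign s (250 * p) x
    · exact Or.inl (hx.le_lamMin_and_lamMax_le hsp hM)
    · exact Or.inr hx
  · refine (gaussMat_not_isRegularDesign_le n p s).trans ?_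
    rw [← ENNReal.ofReal_natCast, ← ENNReal.ofReal_mul (Nat.cast_nonneg _)]
    refine ENNReal.ofReal_le_ofReal ?_
    have := card_grid_mul_exp_le hs (by exact_mod_cast hp) hlog
    have : (0 : ℝ) ≤ 2 / (n * p) := by positivity
    linarith
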